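/- The i-eigenspaces satisfy the direct sum decompositions L₁ ∩ L₂' = ℂ·v_f ⊕ (L₁ ∩ L₂ ∩ S_ℂ^⊥) and L₁ ∩ conj(L₂') = ℂ·v_{if} ⊕ (L₁ ∩ conj(L₂) ∩ S_ℂ^⊥), where conj denotes the image under complex conjugation of W_ℂ. -/

import Mathlib

open Module TensorProduct

/-- The generalized tangent space `W = V ⊕ V*`. -/
abbrev GT (V : Type*) [AddCommGroup V] [Module ℝ V] := V × Module.Dual ℝ V

/-- The canonical symmetric pairing `⟨X+ξ, Y+η⟩ = (1/2)(η(X) + ξ(Y))` on `W = V ⊕ V*`,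
as a bilinear form. -/
noncomputable def gpairB (V : Type*) [AddCommGroup V] [Module ℝ V] :
    LinearMap.BilinForm ℝ (GT V) :=
  (1 / 2 : ℝ) •
    ((LinearMap.id : Module.Dual ℝ V →ₗ[ℝ] Module.Dual ℝ V).compl₁₂
        (LinearMap.snd ℝ V (Module.Dual ℝ V)) (LinearMap.fst ℝ V (Module.Dual ℝ V)) +
      ((LinearMap.id : Module.Dual ℝ V →ₗ[ℝ] Module.Dual ℝ V).compl₁₂
        (LinearMap.snd ℝ V (Module.Dual ℝ V)) (LinearMap.fst ℝ V (Module.Dual ℝ V))).flip)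

/-- A generalized almost complex structure on `V`. -/
def IsGacs {V : Type*} [AddCommGroup V] [Module ℝ V] (J : GT V →ₗ[ℝ] GT V) : Prop :=
  (∀ u, J (J u) = -u) ∧ (∀ u v, gpairB V (J u) v = - gpairB V u (J v))

/-- A generalized almost Hermitian structure on `V`. -/
structure IsGah {V : Type*} [AddCommGroup V] [Module ℝ V]
    (G : GT V →ₗ[ℝ] GT V →ₗ[ℝ] ℝ) (J Gend : GT V →ₗ[ℝ] GT V) : Prop where
  gacs : IsGacs J
  symm : ∀ u v, G u v = G v u
  posdef : ∀ u, u ≠ 0 → 0 < G u u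
  hermitian : ∀ u v, G (J u) (J v) = G u v
  gend_pair : ∀ u v, G u v = gpairB V (Gend u) v
  gend_sq : ∀ u, Gend (Gend u) = u

instance : RingHomSurjective (starRingEnd ℂ) := ⟨fun x => ⟨star x, by simp⟩⟩

/-- Complex conjugation on the complexification `ℂ ⊗ M` of a real module. -/
noncomputable def conjC (M : Type*) [AddCommGroup M] [Module ℝ M] :
    (ℂ ⊗[ℝ] M) →ₛₗ[starRingEnd ℂ] (ℂ ⊗[ℝ] M) where
  toFun := LinearMap.rTensor M Complex.conjAe.toLinearMap
  map_add' x y := map_add _ x y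
  map_smul' c x := by
    show LinearMap.rTensor M Complex.conjAe.toLinearMap (c • x) =
      (starRingEnd ℂ) c • LinearMap.rTensor M Complex.conjAe.toLinearMap x
    induction x using TensorProduct.induction_on with
    | zero => simp
    | tmul a m =>
        rw [smul_tmul', LinearMap.rTensor_tmul, LinearMap.rTensor_tmul, smul_tmul']
        congr 1
        simp [Complex.conjAe]
    | add x y hx hy =>
        rw [smul_add, map_add, hx, hy, map_add, smul_add]

/-- The `(1,0)`-space (`i`-eigenspace) of the complexification of an endomorphism of `W`. -/
noncomputable def iEigen {V : Type*} [AddCommGroup V] [Module ℝ V]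
    (J : GT V →ₗ[ℝ] GT V) : Submodule ℂ (ℂ ⊗[ℝ] GT V) :=
  @Module.End.eigenspace ℂ (ℂ ⊗[ℝ] GT V) _ _ _ (J.baseChange ℂ) Complex.I

/-- The projection `pr_T : W_ℂ → V_ℂ`. -/
noncomputable def prTc (V : Type*) [AddCommGroup V] [Module ℝ V] :
    (ℂ ⊗[ℝ] GT V) →ₗ[ℂ] ℂ ⊗[ℝ] V :=
  (LinearMap.fst ℝ V (Module.Dual ℝ V)).baseChange ℂ

/-- The intersection of the `i`-eigenspace of `J` with the `±i`-eigenspace of the modification `K`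
of `G ∘ J` along the span of `e`, `J e`, `G e`, `G (J e)`. -/
theorem eigenspace_inf_eigenspace_modification {M : Type*} [AddCommGroup M] [Module ℂ M]
    (B : LinearMap.BilinForm ℂ M) (J G K : M →ₗ[ℂ] M) (e : M) (a f ε : ℂ)
    (ha : a ≠ 0) (hf : f ≠ 0) (hε : ε * ε = 1)
    (hJ : ∀ u, J (J u) = -u) (hG : ∀ u, G (G u) = u) (hGJ : ∀ u, J (G u) = G (J u))
    (hBJ : ∀ u v, B (J u) v = -B u (J v)) (hBG : ∀ u v, B (G u) v = B u (G v))
    (hee : B e e = 0) (heg : B e (G e) = a) (hpe : B e (J e) = 0) (hph : B e (G (J e)) = 0)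
    (hK : ∀ w, K w = G (J w)
      + ((f ^ 2)⁻¹ - 1) • a⁻¹ • (B (G e) w • G (J e) - B (G (J e)) w • G e)
      + (f ^ 2 - 1) • a⁻¹ • (B e w • J e - B (J e) w • e))
    (P : Submodule ℂ M)
    (hP : ∀ x, x ∈ P ↔ B e x = 0 ∧ B (J e) x = 0 ∧ B (G e) x = 0 ∧ B (G (J e)) x = 0)
    (v : M) (hv : v = e - Complex.I • J e + (ε * (f ^ 2)⁻¹) • (G e - Complex.I • G (J e))) :
    End.eigenspace J Complex.I ⊓ End.eigenspace K (ε * Complex.I) =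
        (ℂ ∙ v) ⊔ (End.eigenspace J Complex.I ⊓ End.eigenspace (G ∘ₗ J) (ε * Complex.I) ⊓ P) ∧
      (ℂ ∙ v) ⊓ (End.eigenspace J Complex.I ⊓ End.eigenspace (G ∘ₗ J) (ε * Complex.I) ⊓ P) = ⊥ := by
  have hI := Complex.I_mul_I
  have hJe {x : M} (hx : J x = Complex.I • x) : B (J e) x = -(Complex.I * B e x) := by
    simp [hBJ, hx]
  have hGJe {x : M} (hx : J x = Complex.I • x) : B (G (J e)) x = -(Complex.I * B (G e) x) := by
    simp [← hGJ, hBJ, hx]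
  have hev : B e v = ε * (f ^ 2)⁻¹ * a := by simp [hv, hee, heg, hpe, hph]
  have hgv : B (G e) v = a := by simp [hv, hBG, hG, hee, heg, hpe, hph]
  have hJv : J v = Complex.I • v := by
    simp only [hv, map_add, map_sub, map_smul, hJ, hGJ, map_neg]
    match_scalars
    · linear_combination hI
    · ring
    · linear_combination (ε * (f ^ 2)⁻¹) * hI
    · ring
  have hKv : K v = (ε * Complex.I) • v := by
    rw [hK, hJe hJv, hGJe hJv, hev, hgv, hJv, hv]
    simp only [map_add, map_sub, map_smul, hG]
    match_scalars <;> field_simp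
    · linear_combination -hε
    · linear_combination (1 - f ^ 2) * hI + Complex.I ^ 2 * hε
    · ring
    · linear_combination (ε * f ^ 2 - ε) * hI
  have hK_perp {x : M} (hx : x ∈ P) : K x = G (J x) := by
    obtain ⟨h1, h2, h3, h4⟩ := (hP x).1 hx
    simp [hK, h1, h2, h3, h4]
  constructor
  · apply le_antisymm
    · rintro x ⟨hx1, hx2⟩
      rw [SetLike.mem_coe, End.mem_eigenspace_iff] at hx1 hx2
      have hb : B (G e) x = ε * f ^ 2 * B e x := by
        have h := congrArg (B e) hx2
        rw [hK, hGJe hx1, hJe hx1, hx1] at h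
        simp only [map_add, map_sub, map_smul, smul_eq_mul, hee, heg, hpe, hph, ← hBG] at h
        field_simp at h
        refine mul_left_cancel₀ (mul_ne_zero Complex.I_ne_zero ha) ?_
        linear_combination h
      have hy1 : J (x - (B (G e) x * a⁻¹) • v) = Complex.I • (x - (B (G e) x * a⁻¹) • v) := by
        rw [map_sub, map_smul, hx1, hJv]; module
      have hy2 : K (x - (B (G e) x * a⁻¹) • v) =
          (ε * Complex.I) • (x - (B (G e) x * a⁻¹) • v) := by
        rw [map_sub, map_smul, hx2, hKv]; module
      have hye : B e (x - (B (G e) x * a⁻¹) • v) = 0 := by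
        simp only [map_sub, map_smul, hev, smul_eq_mul, hb]
        field_simp
        linear_combination (-B e x) * hε
      have hyg : B (G e) (x - (B (G e) x * a⁻¹) • v) = 0 := by
        simp [hgv, ha]
      have hyP : x - (B (G e) x * a⁻¹) • v ∈ P := by
        rw [hP, hJe hy1, hGJe hy1, hye, hyg]; simp
      rw [← add_sub_cancel ((B (G e) x * a⁻¹) • v) x]
      refine Submodule.add_mem_sup
        (Submodule.smul_mem _ _ (Submodule.mem_span_singleton_self v)) ⟨⟨?_, ?_⟩, hyP⟩
      · exact End.mem_eigenspace_iff.2 hy1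
      · exact End.mem_eigenspace_iff.2 ((hK_perp hyP).symm.trans hy2)
    · refine sup_le ?_ ?_
      · rw [Submodule.span_singleton_le_iff_mem]
        exact ⟨End.mem_eigenspace_iff.2 hJv, End.mem_eigenspace_iff.2 hKv⟩
      · rintro x ⟨⟨h1, h2⟩, h3⟩
        exact ⟨h1, End.mem_eigenspace_iff.2
          ((hK_perp h3).trans (End.mem_eigenspace_iff.1 h2))⟩
  · rw [eq_bot_iff]
    rintro x ⟨hx, -, hxP⟩
    obtain ⟨s, rfl⟩ := Submodule.mem_span_singleton.1 hx
    have h := ((hP _).1 hxP).2.2.1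
    rw [map_smul, hgv, smul_eq_mul, mul_eq_zero, or_iff_left ha] at h
    simp [h]

theorem gpairB_comm {V : Type*} [AddCommGroup V] [Module ℝ V] (u v : GT V) :
    gpairB V u v = gpairB V v u := by
  simp [gpairB, add_comm]

theorem gpairB_vector_self {V : Type*} [AddCommGroup V] [Module ℝ V] (X : V) :
    gpairB V (X, 0) (X, 0) = 0 := by
  simp [gpairB]

namespace IsGah

variable {V : Type*} [AddCommGroup V] [Module ℝ V]
  {G : GT V →ₗ[ℝ] GT V →ₗ[ℝ] ℝ} {J Gend : GT V →ₗ[ℝ] GT V}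

theorem gpairB_Gend (h : IsGah G J Gend) (u v : GT V) :
    gpairB V (Gend u) v = gpairB V u (Gend v) := by
  rw [← h.gend_pair, h.symm, h.gend_pair, gpairB_comm]

theorem gpairB_nondegenerate (h : IsGah G J Gend) {u : GT V} (hu : ∀ v, gpairB V u v = 0) :
    u = 0 := by
  by_contra h0
  have := h.posdef u h0
  rw [h.gend_pair, h.gpairB_Gend, hu] at this
  exact this.false

theorem J_Gend (h : IsGah G J Gend) (u : GT V) : J (Gend u) = Gend (J u) := by
  have key : J (Gend (J u)) = -Gend u := by
    rw [← sub_eq_zero]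
    refine h.gpairB_nondegenerate fun v => ?_
    have := h.hermitian u v
    rw [h.gend_pair, h.gend_pair] at this
    simp [h.gacs.2, this]
  have h2 := congrArg J key
  rw [h.gacs.1, map_neg, neg_inj] at h2
  exact h2.symm

theorem gpairB_Gend_self_ne_zero (h : IsGah G J Gend) {u : GT V} (hu : u ≠ 0) :
    gpairB V u (Gend u) ≠ 0 := by
  rw [← h.gpairB_Gend, ← h.gend_pair]
  exact (h.posdef u hu).ne'

theorem gpairB_J_self (h : IsGah G J Gend) (u : GT V) : gpairB V u (J u) = 0 := by
  have := h.gacs.2 u u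
  rw [gpairB_comm] at this
  linarith

theorem gpairB_Gend_J_self (h : IsGah G J Gend) (u : GT V) : gpairB V u (Gend (J u)) = 0 := by
  have := h.gacs.2 u (Gend u)
  rw [h.J_Gend, gpairB_comm, h.gpairB_Gend] at this
  linarith

/-- The conjugate of `Gend ∘ J` by an automorphism rescaling the span of
`e`, `J e`, `Gend e`, `Gend (J e)`. -/
theorem conj_rescaling (h : IsGah G J Gend) (e : GT V) (he : e ≠ 0) (hee : gpairB V e e = 0)
    (f : ℝ) (hf : f ≠ 0) (τ : GT V ≃ₗ[ℝ] GT V)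
    (hperp : ∀ w, gpairB V e w = 0 → gpairB V (J e) w = 0 → gpairB V (Gend e) w = 0 →
      gpairB V (Gend (J e)) w = 0 → τ w = w)
    (hτ0 : τ e = f • e) (hτ1 : τ (J e) = f • J e)
    (hτ2 : τ (Gend (J e)) = f⁻¹ • Gend (J e)) (hτ3 : τ (Gend e) = f⁻¹ • Gend e) (w : GT V) :
    τ (Gend (J (τ.symm w))) = Gend (J w)
      + ((f ^ 2)⁻¹ - 1) • (gpairB V e (Gend e))⁻¹ •
        (gpairB V (Gend e) w • Gend (J e) - gpairB V (Gend (J e)) w • Gend e)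
      + (f ^ 2 - 1) • (gpairB V e (Gend e))⁻¹ • (gpairB V e w • J e - gpairB V (J e) w • e) := by
  have ha := h.gpairB_Gend_self_ne_zero he
  have hpe := h.gpairB_J_self e
  have hph := h.gpairB_Gend_J_self e
  set a := gpairB V e (Gend e) with ha_def
  have hJ := h.gacs.1
  have hG := h.gend_sq
  have hBJ := h.gacs.2
  have hBG := h.gpairB_Gend
  have hGJ := h.J_Gend
  have s0 : τ.symm e = f⁻¹ • e := by rw [LinearEquiv.symm_apply_eq]; simp [hτ0, hf]
  have s1 : τ.symm (J e) = f⁻¹ • J e := by rw [LinearEquiv.symm_apply_eq]; simp [hτ1, hf]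
  have s2 : τ.symm (Gend (J e)) = f • Gend (J e) := by
    rw [LinearEquiv.symm_apply_eq]; simp [hτ2, hf]
  have s3 : τ.symm (Gend e) = f • Gend e := by rw [LinearEquiv.symm_apply_eq]; simp [hτ3, hf]
  obtain ⟨y, hy⟩ : ∃ y, y = w - a⁻¹ • (gpairB V (Gend e) w • e + gpairB V (Gend (J e)) w • J e
    + gpairB V e w • Gend e + gpairB V (J e) w • Gend (J e)) := ⟨_, rfl⟩
  have y0 : gpairB V e y = 0 := by
    simp [hy, hee, hpe, hph, ← ha_def]
    field_simp
    ring
  have y1 : gpairB V (J e) y = 0 := by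
    simp [hy, hee, hpe, hph, ← ha_def, hBJ, hJ, hGJ]
    field_simp
    ring
  have y2 : gpairB V (Gend e) y = 0 := by
    simp [hy, hee, hpe, hph, ← ha_def, hBG, hG]
    field_simp
    ring
  have y3 : gpairB V (Gend (J e)) y = 0 := by
    simp [hy, hee, hpe, hph, ← ha_def, hBJ, hBG, hJ, hGJ, hG]
    field_simp
    ring
  have ty : τ.symm y = y := by
    rw [LinearEquiv.symm_apply_eq, hperp y y0 y1 y2 y3]
  have tKy : τ (Gend (J y)) = Gend (J y) := by
    apply hperp
    · rw [← hBG, ← neg_eq_iff_eq_neg.2 (hBJ _ _), hGJ, y3, neg_zero]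
    · rw [← hBG, ← neg_eq_iff_eq_neg.2 (hBJ _ _), hGJ, hJ]; simp [y2]
    · rw [← hBG, ← neg_eq_iff_eq_neg.2 (hBJ _ _), hG, y1, neg_zero]
    · rw [← hBG, ← neg_eq_iff_eq_neg.2 (hBJ _ _), hG, hJ]; simp [y0]
  obtain ⟨p, hp⟩ : ∃ p, gpairB V (Gend e) w = a * p := ⟨a⁻¹ * _, (mul_inv_cancel_left₀ ha _).symm⟩
  obtain ⟨q, hq⟩ : ∃ q, gpairB V (Gend (J e)) w = a * q :=
    ⟨a⁻¹ * _, (mul_inv_cancel_left₀ ha _).symm⟩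
  obtain ⟨r, hr⟩ : ∃ r, gpairB V e w = a * r := ⟨a⁻¹ * _, (mul_inv_cancel_left₀ ha _).symm⟩
  obtain ⟨s, hs⟩ : ∃ s, gpairB V (J e) w = a * s := ⟨a⁻¹ * _, (mul_inv_cancel_left₀ ha _).symm⟩
  rw [hp, hq, hr, hs] at hy ⊢
  have hw : w = y + (p • e + q • J e + r • Gend e + s • Gend (J e)) := by
    rw [hy]
    match_scalars <;> field_simp <;> ring
  rw [hw]
  simp only [map_add, map_smul, map_neg, ty, s0, s1, s2, s3, hJ, hGJ, hG, tKy, hτ0, hτ1, hτ2, hτ3]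
  match_scalars <;> field_simp <;> ring

end IsGah

section Complexification

variable {M : Type*} [AddCommGroup M] [Module ℝ M]

theorem conjC_tmul (z : ℂ) (m : M) : conjC M (z ⊗ₜ[ℝ] m) = star z ⊗ₜ[ℝ] m := rfl

theorem conjC_conjC (x : ℂ ⊗[ℝ] M) : conjC M (conjC M x) = x := by
  induction x using TensorProduct.induction_on with
  | zero => simp
  | tmul z m => simp [conjC_tmul]
  | add x y hx hy => rw [map_add, map_add, hx, hy]

theorem baseChange_conjC (K : M →ₗ[ℝ] M) (x : ℂ ⊗[ℝ] M) :
    K.baseChange ℂ (conjC M x) = conjC M (K.baseChange ℂ x) := by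
  induction x using TensorProduct.induction_on with
  | zero => simp
  | tmul z m => simp [conjC_tmul]
  | add x y hx hy => simp only [map_add, hx, hy]

theorem map_conjC_eigenspace (K : M →ₗ[ℝ] M) (c : ℂ) :
    (End.eigenspace (K.baseChange ℂ) c).map (conjC M) =
      End.eigenspace (K.baseChange ℂ) (star c) := by
  ext x
  simp only [Submodule.mem_map, End.mem_eigenspace_iff]
  constructor
  · rintro ⟨y, hy, rfl⟩
    rw [baseChange_conjC, hy, map_smulₛₗ]; rfl
  · intro hx
    refine ⟨conjC M x, ?_, conjC_conjC x⟩
    rw [baseChange_conjC, hx, map_smulₛₗ]; simp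

theorem mem_orthogonal_baseChange_span (B : LinearMap.BilinForm ℝ M) (s : Set M)
    (x : ℂ ⊗[ℝ] M) :
    x ∈ (B.baseChange ℂ).orthogonal ((Submodule.span ℝ s).baseChange ℂ) ↔
      ∀ m ∈ s, B.baseChange ℂ (1 ⊗ₜ[ℝ] m) x = 0 := by
  rw [LinearMap.BilinForm.mem_orthogonal_iff, Submodule.baseChange_span]
  constructor
  · intro h m hm
    exact h _ (Submodule.subset_span ⟨m, hm, rfl⟩)
  · intro h n hn
    change B.baseChange ℂ n x = 0
    induction hn using Submodule.span_induction with
    | mem n hn => obtain ⟨m, hm, rfl⟩ := hn; exact h m hm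
    | zero => simp
    | add a b _ _ ha hb => simp [ha, hb]
    | smul c a _ ha => simp [ha]

end Complexification

/-- the `i`-eigenspaces satisfy the direct sum decompositions
`L₁ ⊓ L₂' = ℂ·v_f ⊕ (L₁ ⊓ L₂ ⊓ S_ℂ^⊥)` and
`L₁ ⊓ conj(L₂') = ℂ·v_{if} ⊕ (L₁ ⊓ conj(L₂) ⊓ S_ℂ^⊥)`. -/
theorem statement13 {V : Type*} [AddCommGroup V] [Module ℝ V] [FiniteDimensional ℝ V]
    (G : GT V →ₗ[ℝ] GT V →ₗ[ℝ] ℝ) (J Gend : GT V →ₗ[ℝ] GT V)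
    (hGah : IsGah G J Gend) (X₀ : V) (hX₀ : X₀ ≠ 0) (f : ℝ) (hf : f ≠ 0)
    (τ : GT V ≃ₗ[ℝ] GT V)
    (hτperp : ∀ w : GT V,
      (∀ s ∈ Submodule.span ℝ {((X₀, 0) : GT V), J (X₀, 0), (Gend ∘ₗ J) (X₀, 0),
          (J ∘ₗ Gend ∘ₗ J) (X₀, 0)}, gpairB V w s = 0) → τ w = w)
    (hτ0 : τ ((X₀, 0) : GT V) = f • ((X₀, 0) : GT V))
    (hτ1 : τ (J (X₀, 0)) = f • J (X₀, 0))
    (hτ2 : τ ((Gend ∘ₗ J) (X₀, 0)) = f⁻¹ • (Gend ∘ₗ J) (X₀, 0))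
    (hτ3 : τ ((J ∘ₗ Gend ∘ₗ J) (X₀, 0)) = f⁻¹ • (J ∘ₗ Gend ∘ₗ J) (X₀, 0)) :
    letI e : GT V := (X₀, 0)
    letI J₂ : GT V →ₗ[ℝ] GT V := Gend ∘ₗ J
    letI J₃ : GT V →ₗ[ℝ] GT V := J ∘ₗ Gend ∘ₗ J
    letI S : Submodule ℝ (GT V) := Submodule.span ℝ {e, J e, J₂ e, J₃ e}
    letI J₂' : GT V →ₗ[ℝ] GT V := τ.toLinearMap ∘ₗ J₂ ∘ₗ τ.symm.toLinearMap
    letI L₁ := iEigen J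
    letI L₂ := iEigen J₂
    letI L₂' := iEigen J₂'
    letI Scperp := ((gpairB V).baseChange ℂ).orthogonal (S.baseChange ℂ)
    letI ι : GT V → ℂ ⊗[ℝ] GT V := fun w => (1 : ℂ) ⊗ₜ[ℝ] w
    letI vf : ℂ ⊗[ℝ] GT V := ι e - Complex.I • ι (J e)
      - ((f : ℂ) ^ 2)⁻¹ • (ι (J₃ e) + Complex.I • ι (J₂ e))
    letI vif : ℂ ⊗[ℝ] GT V := ι e - Complex.I • ι (J e)
      + ((f : ℂ) ^ 2)⁻¹ • (ι (J₃ e) + Complex.I • ι (J₂ e))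
    (L₁ ⊓ L₂' = (ℂ ∙ vf) ⊔ (L₁ ⊓ L₂ ⊓ Scperp) ∧
      (ℂ ∙ vf) ⊓ (L₁ ⊓ L₂ ⊓ Scperp) = ⊥) ∧
    (L₁ ⊓ L₂'.map (conjC (GT V)) =
        (ℂ ∙ vif) ⊔ (L₁ ⊓ L₂.map (conjC (GT V)) ⊓ Scperp) ∧
      (ℂ ∙ vif) ⊓ (L₁ ⊓ L₂.map (conjC (GT V)) ⊓ Scperp) = ⊥) := by
  have he : ((X₀, 0) : GT V) ≠ 0 := by simpa using hX₀
  have hee := gpairB_vector_self X₀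
  generalize ((X₀, 0) : GT V) = e at *
  have hJ₃ : J (Gend (J e)) = -Gend e := by rw [hGah.J_Gend, hGah.gacs.1, map_neg]
  simp only [LinearMap.comp_apply, hJ₃, map_neg, smul_neg, neg_inj] at hτperp hτ0 hτ1 hτ2 hτ3
  have hperp : ∀ w, gpairB V e w = 0 → gpairB V (J e) w = 0 → gpairB V (Gend e) w = 0 →
      gpairB V (Gend (J e)) w = 0 → τ w = w := by
    intro w h0 h1 h2 h3
    refine hτperp w fun s hs => ?_
    rw [gpairB_comm]
    induction hs using Submodule.span_induction with
    | mem s hs =>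
      obtain rfl | rfl | rfl | rfl := hs
      exacts [h0, h1, h3, by simp [h2]]
    | zero => simp
    | add a b _ _ ha hb => simp [ha, hb]
    | smul c a _ ha => simp [ha]
  have hconj := hGah.conj_rescaling e he hee f hf τ hperp hτ0 hτ1 hτ2 hτ3
  have hBJ : ∀ u v, (gpairB V).baseChange ℂ (J.baseChange ℂ u) v =
      -(gpairB V).baseChange ℂ u (J.baseChange ℂ v) := by
    intro u v
    induction u using TensorProduct.induction_on with
    | zero => simp
    | add x y hx hy => simp only [map_add, LinearMap.add_apply, hx, hy, neg_add]
    | tmul z x =>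
      induction v using TensorProduct.induction_on with
      | zero => simp
      | add x y hx hy => simp only [map_add, hx, hy, neg_add]
      | tmul z' y => simp [hGah.gacs.2]
  have hBG : ∀ u v, (gpairB V).baseChange ℂ (Gend.baseChange ℂ u) v =
      (gpairB V).baseChange ℂ u (Gend.baseChange ℂ v) := by
    intro u v
    induction u using TensorProduct.induction_on with
    | zero => simp
    | add x y hx hy => simp only [map_add, LinearMap.add_apply, hx, hy]
    | tmul z x =>
      induction v using TensorProduct.induction_on with
      | zero => simp
      | add x y hx hy => simp only [map_add, hx, hy]
      | tmul z' y => simp [hGah.gpairB_Gend]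
  have key := fun ε hε => eigenspace_inf_eigenspace_modification ((gpairB V).baseChange ℂ)
    (J.baseChange ℂ) (Gend.baseChange ℂ)
    ((τ.toLinearMap ∘ₗ (Gend ∘ₗ J) ∘ₗ τ.symm.toLinearMap).baseChange ℂ) (1 ⊗ₜ[ℝ] e)
    (gpairB V e (Gend e) : ℂ) (f : ℂ) ε
    (by exact_mod_cast hGah.gpairB_Gend_self_ne_zero he) (by exact_mod_cast hf) hε
    (by
      intro u
      induction u using TensorProduct.induction_on with
      | zero => simp
      | add x y hx hy => simp only [map_add, hx, hy, neg_add]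
      | tmul z x => simp [hGah.gacs.1, TensorProduct.tmul_neg])
    (by
      intro u
      induction u using TensorProduct.induction_on with
      | zero => simp
      | add x y hx hy => simp only [map_add, hx, hy]
      | tmul z x => simp [hGah.gend_sq])
    (by
      intro u
      induction u using TensorProduct.induction_on with
      | zero => simp
      | add x y hx hy => simp only [map_add, hx, hy]
      | tmul z x => simp [hGah.J_Gend])
    hBJ hBG (by simp [hee]) (by simp) (by simp [hGah.gpairB_J_self])
    (by simp [hGah.gpairB_Gend_J_self])
    (by
      intro u
      induction u using TensorProduct.induction_on with
      | zero => simp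
      | add x y hx hy =>
        simp only [map_add, hx, hy]
        module
      | tmul z x =>
        have hr (r : ℝ) (m : GT V) : z ⊗ₜ[ℝ] (r • m) = ((r : ℂ) * z) • (1 : ℂ) ⊗ₜ[ℝ] m := by
          simp [TensorProduct.smul_tmul']
        have hz (m : GT V) : z ⊗ₜ[ℝ] m = z • (1 : ℂ) ⊗ₜ[ℝ] m := by
          simp [TensorProduct.smul_tmul']
        simp only [LinearMap.baseChange_tmul, LinearMap.comp_apply, LinearEquiv.coe_coe, hconj,
          LinearMap.BilinForm.baseChange_tmul, smul_sub, smul_smul, TensorProduct.tmul_add,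
          TensorProduct.tmul_sub, hr]
        rw [hz (Gend (J x))]
        simp
        module)
    (((gpairB V).baseChange ℂ).orthogonal
      ((Submodule.span ℝ {e, J e, Gend (J e), -Gend e}).baseChange ℂ))
    (by
      intro x
      rw [mem_orthogonal_baseChange_span]
      simp [TensorProduct.tmul_neg]
      tauto)
  have hcomp : Gend.baseChange ℂ ∘ₗ J.baseChange ℂ = (Gend ∘ₗ J).baseChange ℂ :=
    (LinearMap.baseChange_comp _ _).symm
  simp only [hcomp] at key
  have h1 := key 1 (one_mul 1) (1 ⊗ₜ[ℝ] e - Complex.I • 1 ⊗ₜ[ℝ] J e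
      - ((f : ℂ) ^ 2)⁻¹ • (1 ⊗ₜ[ℝ] (-Gend e) + Complex.I • 1 ⊗ₜ[ℝ] Gend (J e))) (by
    simp only [LinearMap.baseChange_tmul, TensorProduct.tmul_neg]
    module)
  have h2 := key (-1) (by norm_num) (1 ⊗ₜ[ℝ] e - Complex.I • 1 ⊗ₜ[ℝ] J e
      + ((f : ℂ) ^ 2)⁻¹ • (1 ⊗ₜ[ℝ] (-Gend e) + Complex.I • 1 ⊗ₜ[ℝ] Gend (J e))) (by
    simp only [LinearMap.baseChange_tmul, TensorProduct.tmul_neg]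
    module)
  rw [one_mul] at h1
  rw [neg_one_mul, ← Complex.conj_I] at h2
  simp only [iEigen, map_conjC_eigenspace, LinearMap.comp_apply, hJ₃]
  exact ⟨h1, h2⟩
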